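/- arXiv:1504.01166 — 5 statements merged into one kernel-verified Lean document; each statement's English description precedes it below -/
import Mathlib

section
/- For all strictly positive definite real d×d matrices C₁, C₂ and all λ₁, λ₂ ≥ 0 with λ₁ + λ₂ = 1, one has log det(λ₁C₁ + λ₂C₂) − λ₁ log det C₁ − λ₂ log det C₂ ≥ 0 (the Ky Fan inequality: log det is concave on positive definite matrices). -/
open Matrix Real

/-- The logarithm of the determinant is bounded by its tangent at the identity matrix. -/
theorem Matrix.PosDef.log_det_le_trace_sub_card {n : Type*} [Fintype n] [DecidableEq n]
    {A : Matrix n n ℝ} (hA : A.PosDef) :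
    Real.log A.det ≤ A.trace - Fintype.card n := by
  rw [hA.1.det_eq_prod_eigenvalues, hA.1.trace_eq_sum_eigenvalues]
  simp only [RCLike.ofReal_real_eq_id, id_eq]
  rw [Real.log_prod fun i _ ↦ (hA.eigenvalues_pos i).ne']
  calc ∑ i, Real.log (hA.1.eigenvalues i)
      ≤ ∑ i, (hA.1.eigenvalues i - 1) :=
        Finset.sum_le_sum fun i _ ↦ Real.log_le_sub_one_of_pos (hA.eigenvalues_pos i)
    _ = ∑ i, hA.1.eigenvalues i - Fintype.card n := by simp

open scoped MatrixOrder in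
/-- The logarithm of the determinant is bounded by its tangent at any positive definite matrix. -/
theorem Matrix.PosDef.log_det_le_log_det_add {n : Type*} [Fintype n] [DecidableEq n]
    {M C : Matrix n n ℝ} (hM : M.PosDef) (hC : C.PosDef) :
    Real.log C.det ≤ Real.log M.det + ((M⁻¹ * C).trace - Fintype.card n) := by
  obtain ⟨B, hB⟩ := CStarAlgebra.nonneg_iff_eq_star_mul_self.mp hM.inv.posSemidef.nonneg
  rw [star_eq_conjTranspose] at hB
  have hBC : B.det * B.det * M.det = 1 := by
    have h : M⁻¹.det = B.det * B.det := by simp [hB]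
    rw [← h, ← det_mul, nonsing_inv_mul _ hM.det_pos.ne'.isUnit, det_one]
  have hB0 : B.det ≠ 0 := fun h ↦ by simp [h] at hBC
  have hpos : (B * C * Bᴴ).PosDef :=
    hC.mul_mul_conjTranspose_same <|
      vecMul_injective_of_isUnit ((isUnit_iff_isUnit_det B).2 hB0.isUnit)
  have hdet : C.det = M.det * (B * C * Bᴴ).det := by
    simp only [det_mul, det_conjTranspose, star_trivial]
    linear_combination -C.det * hBC
  have htrace : (M⁻¹ * C).trace = (B * C * Bᴴ).trace := by
    rw [hB, Matrix.mul_assoc, trace_mul_comm]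
  rw [hdet, Real.log_mul hM.det_pos.ne' hpos.det_pos.ne', htrace]
  gcongr
  exact hpos.log_det_le_trace_sub_card

/-- **Ky Fan inequality**: `log det` is concave on positive definite matrices. -/
theorem ky_fan_inequality {d : ℕ} (C₁ C₂ : Matrix (Fin d) (Fin d) ℝ)
    (hC₁ : C₁.PosDef) (hC₂ : C₂.PosDef)
    (l₁ l₂ : ℝ) (hl₁ : 0 ≤ l₁) (hl₂ : 0 ≤ l₂) (hsum : l₁ + l₂ = 1) :
    0 ≤ Real.log (l₁ • C₁ + l₂ • C₂).det
        - l₁ * Real.log C₁.det - l₂ * Real.log C₂.det := by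
  set M := l₁ • C₁ + l₂ • C₂ with hMdef
  have hM : M.PosDef := by
    rcases hl₁.eq_or_lt with rfl | hpos
    · obtain rfl : l₂ = 1 := by linarith
      simpa [hMdef] using hC₂
    · exact (hC₁.smul hpos).add_posSemidef (hC₂.posSemidef.smul hl₂)
  have htrace : l₁ * (M⁻¹ * C₁).trace + l₂ * (M⁻¹ * C₂).trace = Fintype.card (Fin d) := by
    have h : (M⁻¹ * M).trace = Fintype.card (Fin d) := by
      rw [nonsing_inv_mul _ hM.det_pos.ne'.isUnit, trace_one]
    rw [← h]
    nth_rw 4 [hMdef]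
    simp only [Matrix.mul_add, Matrix.mul_smul, trace_add, trace_smul, smul_eq_mul]
  have h₁ := mul_le_mul_of_nonneg_left (hM.log_det_le_log_det_add hC₁) hl₁
  have h₂ := mul_le_mul_of_nonneg_left (hM.log_det_le_log_det_add hC₂) hl₂
  have hlog : (l₁ + l₂) * (Real.log M.det - Fintype.card (Fin d)) =
      Real.log M.det - Fintype.card (Fin d) := by rw [hsum, one_mul]
  linarith
end

section
/- For strictly positive definite real d×d matrices C₁, C₂ and λ₁, λ₂ ≥ 0 with λ₁ + λ₂ = 1, equality holds in the Ky Fan inequality, i.e. log det(λ₁C₁ + λ₂C₂) = λ₁ log det C₁ + λ₂ log det C₂, if and only if λ₁λ₂ = 0 or C₁ = C₂. -/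
open Matrix Real

open scoped MatrixOrder Matrix.Norms.L2Operator in
/-- Two positive definite real matrices are simultaneously diagonalized by a congruence that sends
the first one to the identity. -/
theorem Matrix.PosDef.exists_simultaneous_diagonalization {n : Type*} [Fintype n] [DecidableEq n]
    {A B : Matrix n n ℝ} (hA : A.PosDef) (hB : B.PosDef) :
    ∃ (Q : Matrix n n ℝ) (μ : n → ℝ), IsUnit Q ∧ (∀ i, 0 < μ i) ∧
      A = star Q * Q ∧ B = star Q * diagonal μ * Q := by
  obtain ⟨S, hS, rfl⟩ :=
    CStarAlgebra.isStrictlyPositive_iff_eq_star_mul_self.mp hA.isStrictlyPositive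
  obtain ⟨u, rfl⟩ := hS
  set T : Matrix n n ℝ := ((u⁻¹ : (Matrix n n ℝ)ˣ) : Matrix n n ℝ)
  have hTu : T * u = 1 := u.inv_mul
  have huT : star (u : Matrix n n ℝ) * star T = 1 := by rw [← star_mul, hTu, star_one]
  have hM : (star T * B * T).PosDef :=
    (IsUnit.posDef_star_left_conjugate_iff u⁻¹.isUnit).mpr hB
  let U := hM.1.eigenvectorUnitary
  have hUU : (U : Matrix n n ℝ) * star (U : Matrix n n ℝ) = 1 := Unitary.coe_mul_star_self U
  refine ⟨star (U : Matrix n n ℝ) * u, hM.1.eigenvalues,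
    (Unitary.isUnit_coe (U := star U)).mul u.isUnit, hM.eigenvalues_pos, ?_, ?_⟩
  · rw [star_mul, star_star, mul_assoc, ← mul_assoc (U : Matrix n n ℝ), hUU, one_mul]
  · have hspec : star T * B * T = (U : Matrix n n ℝ) * diagonal hM.1.eigenvalues
        * star (U : Matrix n n ℝ) := hM.1.spectral_theorem
    calc B = (star (u : Matrix n n ℝ) * star T) * B * (T * u) := by rw [huT, hTu]; simp
      _ = star (u : Matrix n n ℝ) * (star T * B * T) * u := by simp only [mul_assoc]
      _ = star (u : Matrix n n ℝ) * ((U : Matrix n n ℝ) * diagonal hM.1.eigenvalues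
          * star (U : Matrix n n ℝ)) * u := congrArg (fun X ↦ star (u : Matrix n n ℝ) * X * u) hspec
      _ = _ := by rw [star_mul, star_star]; simp only [mul_assoc]

/-- Log-determinant of a matrix congruent to a positive diagonal matrix. -/
theorem Matrix.log_det_star_mul_diagonal_mul {n : Type*} [Fintype n] [DecidableEq n]
    {Q : Matrix n n ℝ} (hQ : IsUnit Q) {μ : n → ℝ} (hμ : ∀ i, 0 < μ i) :
    Real.log (star Q * diagonal μ * Q).det = 2 * Real.log Q.det + ∑ i, Real.log (μ i) := by
  have hdet : Q.det ≠ 0 := ((isUnit_iff_isUnit_det Q).mp hQ).ne_zero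
  have hprod : ∏ i, μ i ≠ 0 := Finset.prod_ne_zero_iff.mpr fun i _ ↦ (hμ i).ne'
  rw [det_mul, det_mul, det_diagonal, star_eq_conjTranspose, det_conjTranspose, star_trivial,
    Real.log_mul (mul_ne_zero hdet hprod) hdet, Real.log_mul hdet hprod,
    Real.log_prod fun i _ ↦ (hμ i).ne']
  ring

/-- Equality case in the **Ky Fan inequality**. -/
theorem ky_fan_equality_iff {d : ℕ} (C₁ C₂ : Matrix (Fin d) (Fin d) ℝ)
    (hC₁ : C₁.PosDef) (hC₂ : C₂.PosDef)
    (l₁ l₂ : ℝ) (hl₁ : 0 ≤ l₁) (hl₂ : 0 ≤ l₂) (hsum : l₁ + l₂ = 1) :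
    Real.log (l₁ • C₁ + l₂ • C₂).det
      = l₁ * Real.log C₁.det + l₂ * Real.log C₂.det ↔ l₁ * l₂ = 0 ∨ C₁ = C₂ := by
  constructor
  · intro h
    refine or_iff_not_imp_left.mpr fun hne ↦ ?_
    have hl₁' : 0 < l₁ := hl₁.lt_of_ne' (left_ne_zero_of_mul hne)
    have hl₂' : 0 < l₂ := hl₂.lt_of_ne' (right_ne_zero_of_mul hne)
    obtain ⟨Q, μ, hQ, hμ, rfl, rfl⟩ := hC₁.exists_simultaneous_diagonalization hC₂
    have hone : star Q * Q = star Q * diagonal (fun _ ↦ 1) * Q := by simp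
    have hcomb : l₁ • (star Q * Q) + l₂ • (star Q * diagonal μ * Q)
        = star Q * diagonal (fun i ↦ l₁ + l₂ * μ i) * Q := by
      have hdiag : diagonal (fun i ↦ l₁ + l₂ * μ i) = l₁ • 1 + l₂ • diagonal μ := by
        rw [← diagonal_one, ← diagonal_smul, ← diagonal_smul, diagonal_add]
        simp
      simp [hdiag, mul_add, add_mul]
    rw [hcomb, hone, log_det_star_mul_diagonal_mul hQ fun i ↦ by have := hμ i; positivity,
      log_det_star_mul_diagonal_mul hQ fun _ ↦ one_pos, log_det_star_mul_diagonal_mul hQ hμ] at h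
    have hsums : ∑ i, l₂ * Real.log (μ i) = ∑ i, Real.log (l₁ + l₂ * μ i) := by
      rw [← Finset.mul_sum]
      simp only [Real.log_one, Finset.sum_const_zero] at h
      linear_combination -h - 2 * Real.log Q.det * hsum
    have hstrict : ∀ i, μ i ≠ 1 → l₂ * Real.log (μ i) < Real.log (l₁ + l₂ * μ i) := fun i hi ↦ by
      simpa using strictConcaveOn_log_Ioi.2 (Set.mem_Ioi.mpr one_pos) (Set.mem_Ioi.mpr (hμ i))
        hi.symm hl₁' hl₂' hsum
    have hle : ∀ i ∈ Finset.univ, l₂ * Real.log (μ i) ≤ Real.log (l₁ + l₂ * μ i) := fun i _ ↦ by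
      by_cases hi : μ i = 1
      · simp [hi, hsum]
      · exact (hstrict i hi).le
    have heq : μ = fun _ ↦ 1 := funext fun i ↦ by_contra fun hi ↦
      (hstrict i hi).ne ((Finset.sum_eq_sum_iff_of_le hle).mp hsums i (Finset.mem_univ i))
    rw [hone, heq]
  · rintro (h | rfl)
    · rcases mul_eq_zero.mp h with rfl | rfl
      · obtain rfl : l₂ = 1 := by linarith
        simp
      · obtain rfl : l₁ = 1 := by linarith
        simp
    · rw [← add_smul, ← add_mul, hsum, one_smul, one_mul]
end

section
/- (WKFI, inequality part.) Let φ: ℝ^d → [0,∞) be measurable, let C₁, C₂ be symmetric strictly positive definite d×d real matrices, let λ₁, λ₂ ∈ [0,1] with λ₁ + λ₂ = 1, set C = λ₁C₁ + λ₂C₂ and Ψ = λ₁Φ_{φ,C₁} + λ₂Φ_{φ,C₂} − Φ_{φ,C}, assuming all integrals α_φ(C_a), α_φ(C), Φ_{φ,C_a}, Φ_{φ,C} converge absolutely. Assume (i) λ₁α_φ(C₁) + λ₂α_φ(C₂) − α_φ(C) ≥ 0, and (ii) [λ₁α_φ(C₁) + λ₂α_φ(C₂) − α_φ(C)]·log[(2π)^d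 det C] + tr(C⁻¹Ψ) ≤ 0. Then σ_φ(C) − λ₁σ_φ(C₁) − λ₂σ_φ(C₂) ≥ 0. -/
open Matrix Real MeasureTheory

/-- The centered Gaussian density with covariance matrix `C` on `ℝ^d`. -/
noncomputable def gaussDensity {d : ℕ} (C : Matrix (Fin d) (Fin d) ℝ)
    (x : Fin d → ℝ) : ℝ :=
  (2 * Real.pi) ^ (-(d : ℝ) / 2) * C.det ^ (-(1 : ℝ) / 2) *
    Real.exp (-(1 / 2) * (x ⬝ᵥ C⁻¹ *ᵥ x))

/-- `α_φ(C) = ∫ φ(x) f_C(x) dx`. -/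
noncomputable def wAlpha {d : ℕ} (φ : (Fin d → ℝ) → ℝ)
    (C : Matrix (Fin d) (Fin d) ℝ) : ℝ :=
  ∫ x : Fin d → ℝ, φ x * gaussDensity C x

/-- `Φ_{φ,C} = ∫ x xᵀ φ(x) f_C(x) dx` (entrywise). -/
noncomputable def wPhi {d : ℕ} (φ : (Fin d → ℝ) → ℝ)
    (C : Matrix (Fin d) (Fin d) ℝ) : Matrix (Fin d) (Fin d) ℝ :=
  Matrix.of fun i j : Fin d => ∫ x : Fin d → ℝ, x i * x j * φ x * gaussDensity C x

/-- `σ_φ(C) = (α_φ(C)/2)·log[(2π)^d det C] + ½ tr(C⁻¹ Φ_{φ,C})`. -/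
noncomputable def wSigma {d : ℕ} (φ : (Fin d → ℝ) → ℝ)
    (C : Matrix (Fin d) (Fin d) ℝ) : ℝ :=
  (wAlpha φ C / 2) * Real.log ((2 * Real.pi) ^ d * C.det) +
    (1 / 2) * (C⁻¹ * wPhi φ C).trace

theorem gaussDensity_pos {d : ℕ} {C : Matrix (Fin d) (Fin d) ℝ} (hC : C.PosDef)
    (x : Fin d → ℝ) : 0 < gaussDensity C x := by
  have := hC.det_pos
  unfold gaussDensity
  positivity

theorem neg_log_gaussDensity {d : ℕ} {C : Matrix (Fin d) (Fin d) ℝ} (hC : C.PosDef)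
    (x : Fin d → ℝ) :
    -Real.log (gaussDensity C x) =
      (1 / 2) * Real.log ((2 * Real.pi) ^ d * C.det) + (1 / 2) * (x ⬝ᵥ C⁻¹ *ᵥ x) := by
  have hdet := hC.det_pos
  have hpi : (0 : ℝ) < 2 * Real.pi := by positivity
  unfold gaussDensity
  rw [Real.log_mul (by positivity) (by positivity), Real.log_mul (by positivity) (by positivity),
    Real.log_exp, Real.log_rpow hpi, Real.log_rpow hdet, Real.log_mul (by positivity) hdet.ne',
    Real.log_pow]
  ring

/-- The weighted cross-entropy of the Gaussian with covariance `C'` relative to the one with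
covariance `C`, in terms of the weighted moments. -/
noncomputable def wCrossEntropy {d : ℕ} (φ : (Fin d → ℝ) → ℝ)
    (C' C : Matrix (Fin d) (Fin d) ℝ) : ℝ :=
  (wAlpha φ C' / 2) * Real.log ((2 * Real.pi) ^ d * C.det) +
    (1 / 2) * (C⁻¹ * wPhi φ C').trace

theorem mul_neg_log_gaussDensity_eq {d : ℕ} (φ : (Fin d → ℝ) → ℝ)
    (C' : Matrix (Fin d) (Fin d) ℝ) {C : Matrix (Fin d) (Fin d) ℝ} (hC : C.PosDef)
    (x : Fin d → ℝ) :
    φ x * gaussDensity C' x * -Real.log (gaussDensity C x) =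
      φ x * gaussDensity C' x * ((1 / 2) * Real.log ((2 * Real.pi) ^ d * C.det)) +
        (1 / 2) * ∑ i, ∑ j, C⁻¹ i j * (x j * x i * φ x * gaussDensity C' x) := by
  rw [neg_log_gaussDensity hC, mul_add]
  congr 1
  simp only [dotProduct, mulVec, Finset.mul_sum]
  refine Finset.sum_congr rfl fun i _ => Finset.sum_congr rfl fun j _ => ?_
  ring

theorem integrable_mul_neg_log_gaussDensity {d : ℕ} {φ : (Fin d → ℝ) → ℝ}
    {C' C : Matrix (Fin d) (Fin d) ℝ} (hC : C.PosDef)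
    (hα : Integrable (fun x : Fin d → ℝ => φ x * gaussDensity C' x))
    (hΦ : ∀ i j : Fin d,
      Integrable (fun x : Fin d → ℝ => x i * x j * φ x * gaussDensity C' x)) :
    Integrable
      (fun x : Fin d → ℝ => φ x * gaussDensity C' x * -Real.log (gaussDensity C x)) := by
  simp only [mul_neg_log_gaussDensity_eq φ C' hC]
  exact (hα.mul_const _).add <| Integrable.const_mul
    (integrable_finsetSum _ fun i _ => integrable_finsetSum _ fun j _ => (hΦ j i).const_mul _) _

theorem integral_mul_neg_log_gaussDensity {d : ℕ} {φ : (Fin d → ℝ) → ℝ}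
    {C' C : Matrix (Fin d) (Fin d) ℝ} (hC : C.PosDef)
    (hα : Integrable (fun x : Fin d → ℝ => φ x * gaussDensity C' x))
    (hΦ : ∀ i j : Fin d,
      Integrable (fun x : Fin d → ℝ => x i * x j * φ x * gaussDensity C' x)) :
    ∫ x : Fin d → ℝ, φ x * gaussDensity C' x * -Real.log (gaussDensity C x) =
      wCrossEntropy φ C' C := by
  have hrow (i : Fin d) : Integrable fun x : Fin d → ℝ =>
      ∑ j, C⁻¹ i j * (x j * x i * φ x * gaussDensity C' x) :=
    integrable_finsetSum _ fun j _ => (hΦ j i).const_mul _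
  simp only [mul_neg_log_gaussDensity_eq φ C' hC]
  rw [integral_add (hα.mul_const _) ((integrable_finsetSum _ fun i _ => hrow i).const_mul _),
    integral_mul_const, integral_const_mul, integral_finsetSum _ fun i _ => hrow i]
  have hsum (i : Fin d) :
      ∫ x : Fin d → ℝ, ∑ j, C⁻¹ i j * (x j * x i * φ x * gaussDensity C' x) =
        ∑ j, C⁻¹ i j * wPhi φ C' j i := by
    rw [integral_finsetSum _ fun j _ => (hΦ j i).const_mul _]
    simp only [integral_const_mul, wPhi, Matrix.of_apply]
  simp only [hsum, wCrossEntropy, wAlpha, Matrix.trace, Matrix.diag, Matrix.mul_apply]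
  ring

theorem sub_le_mul_log_sub_log {p q : ℝ} (hp : 0 < p) (hq : 0 < q) :
    p - q ≤ p * (Real.log p - Real.log q) := by
  have h := Real.log_le_sub_one_of_pos (div_pos hq hp)
  rw [Real.log_div hq.ne' hp.ne'] at h
  have h' := mul_le_mul_of_nonneg_left h hp.le
  have hdiv : p * (q / p - 1) = q - p := by field_simp
  linarith

/-- The weighted Gibbs inequality for Gaussian densities. -/
theorem wAlpha_sub_le_wCrossEntropy_sub_wSigma {d : ℕ} {φ : (Fin d → ℝ) → ℝ}
    (hφ : ∀ x, 0 ≤ φ x) {C' C : Matrix (Fin d) (Fin d) ℝ} (hC' : C'.PosDef) (hC : C.PosDef)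
    (hα' : Integrable (fun x : Fin d → ℝ => φ x * gaussDensity C' x))
    (hα : Integrable (fun x : Fin d → ℝ => φ x * gaussDensity C x))
    (hΦ' : ∀ i j : Fin d,
      Integrable (fun x : Fin d → ℝ => x i * x j * φ x * gaussDensity C' x)) :
    wAlpha φ C' - wAlpha φ C ≤ wCrossEntropy φ C' C - wSigma φ C' := by
  have hσ : wSigma φ C' = wCrossEntropy φ C' C' := rfl
  rw [hσ, ← integral_mul_neg_log_gaussDensity hC hα' hΦ',
    ← integral_mul_neg_log_gaussDensity hC' hα' hΦ', wAlpha, wAlpha, ← integral_sub hα' hα,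
    ← integral_sub (integrable_mul_neg_log_gaussDensity hC hα' hΦ')
      (integrable_mul_neg_log_gaussDensity hC' hα' hΦ')]
  refine integral_mono (hα'.sub hα)
    ((integrable_mul_neg_log_gaussDensity hC hα' hΦ').sub
      (integrable_mul_neg_log_gaussDensity hC' hα' hΦ')) fun x => ?_
  have h := mul_le_mul_of_nonneg_left
    (sub_le_mul_log_sub_log (gaussDensity_pos hC' x) (gaussDensity_pos hC x)) (hφ x)
  simp only
  linarith

theorem posDef_convex_combination {n : Type*} {A B : Matrix n n ℝ}
    (hA : A.PosDef) (hB : B.PosDef) {a b : ℝ} (ha : 0 ≤ a) (hb : 0 ≤ b) (hab : a + b = 1) :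
    (a • A + b • B).PosDef := by
  rcases ha.eq_or_lt with rfl | ha
  · obtain rfl : b = 1 := by linarith
    simpa using hB
  · exact (hA.smul ha).add_posSemidef (hB.posSemidef.smul hb)

/-- **Weighted Ky Fan inequality** (inequality part). -/
theorem weighted_ky_fan_inequality {d : ℕ} (φ : (Fin d → ℝ) → ℝ)
    (hφmeas : Measurable φ) (hφnonneg : ∀ x, 0 ≤ φ x)
    (C₁ C₂ : Matrix (Fin d) (Fin d) ℝ) (hC₁ : C₁.PosDef) (hC₂ : C₂.PosDef)
    (l₁ l₂ : ℝ) (hl₁ : l₁ ∈ Set.Icc (0 : ℝ) 1) (hl₂ : l₂ ∈ Set.Icc (0 : ℝ) 1)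
    (hsum : l₁ + l₂ = 1)
    (hα₁ : Integrable (fun x : Fin d → ℝ => φ x * gaussDensity C₁ x))
    (hα₂ : Integrable (fun x : Fin d → ℝ => φ x * gaussDensity C₂ x))
    (hα : Integrable (fun x : Fin d → ℝ => φ x * gaussDensity (l₁ • C₁ + l₂ • C₂) x))
    (hΦ₁ : ∀ i j : Fin d,
      Integrable (fun x : Fin d → ℝ => x i * x j * φ x * gaussDensity C₁ x))
    (hΦ₂ : ∀ i j : Fin d,
      Integrable (fun x : Fin d → ℝ => x i * x j * φ x * gaussDensity C₂ x))
    (hΦ : ∀ i j : Fin d,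
      Integrable (fun x : Fin d → ℝ =>
        x i * x j * φ x * gaussDensity (l₁ • C₁ + l₂ • C₂) x))
    (hcond₁ : 0 ≤ l₁ * wAlpha φ C₁ + l₂ * wAlpha φ C₂ - wAlpha φ (l₁ • C₁ + l₂ • C₂))
    (hcond₂ :
      (l₁ * wAlpha φ C₁ + l₂ * wAlpha φ C₂ - wAlpha φ (l₁ • C₁ + l₂ • C₂)) *
          Real.log ((2 * Real.pi) ^ d * (l₁ • C₁ + l₂ • C₂).det) +
        ((l₁ • C₁ + l₂ • C₂)⁻¹ *
          (l₁ • wPhi φ C₁ + l₂ • wPhi φ C₂ - wPhi φ (l₁ • C₁ + l₂ • C₂))).trace ≤ 0) :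
    0 ≤ wSigma φ (l₁ • C₁ + l₂ • C₂) - l₁ * wSigma φ C₁ - l₂ * wSigma φ C₂ := by
  have hC := posDef_convex_combination hC₁ hC₂ hl₁.1 hl₂.1 hsum
  set C := l₁ • C₁ + l₂ • C₂
  have h₁ := mul_le_mul_of_nonneg_left
    (wAlpha_sub_le_wCrossEntropy_sub_wSigma hφnonneg hC₁ hC hα₁ hα hΦ₁) hl₁.1
  have h₂ := mul_le_mul_of_nonneg_left
    (wAlpha_sub_le_wCrossEntropy_sub_wSigma hφnonneg hC₂ hC hα₂ hα hΦ₂) hl₂.1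
  have hcross : l₁ * wCrossEntropy φ C₁ C + l₂ * wCrossEntropy φ C₂ C ≤ wSigma φ C := by
    simp only [Matrix.mul_sub, Matrix.mul_add, Matrix.mul_smul, Matrix.trace_sub,
      Matrix.trace_add, Matrix.trace_smul, smul_eq_mul] at hcond₂
    unfold wCrossEntropy wSigma
    linarith
  have hmass : l₁ * wAlpha φ C + l₂ * wAlpha φ C = wAlpha φ C := by
    rw [← add_mul, hsum, one_mul]
  linarith
end

section
/- (Exponentially weighted Ky Fan inequality, equality part.) Let C₁, C₂ be symmetric strictly positive definite d×d real matrices, λ₁, λ₂ ∈ [0,1] with λ₁ + λ₂ = 1, C = λ₁C₁ + λ₂C₂, and let t ∈ S. Then equality ½ log[(2πe)^d det C]·exp(½tᵀCt) = λ₁·½ log[(2πe)^d det C₁]·exp(½tᵀC₁t) + λ₂·½ log[(2πe)^d det C₂]·exp(½tᵀC₂t) holds if and only if λ₁λ₂ = 0 or C₁ = C₂. -/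
open Matrix Real

/-- `F⁽¹⁾(t) = Σ_a λ_a exp(½tᵀC_a t) − exp(½tᵀCt)` with `C = λ₁C₁ + λ₂C₂`. -/
noncomputable def F1 {d : ℕ} (C₁ C₂ : Matrix (Fin d) (Fin d) ℝ) (l₁ l₂ : ℝ)
    (t : Fin d → ℝ) : ℝ :=
  l₁ * Real.exp ((1 / 2) * (t ⬝ᵥ C₁ *ᵥ t)) +
    l₂ * Real.exp ((1 / 2) * (t ⬝ᵥ C₂ *ᵥ t)) -
    Real.exp ((1 / 2) * (t ⬝ᵥ (l₁ • C₁ + l₂ • C₂) *ᵥ t))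

/-- `F⁽²⁾(t) = F⁽¹⁾(t)·log[(2π)^d det C] + Σ_a λ_a exp(½tᵀC_a t)·tr(C⁻¹C_a)
− d·exp(½tᵀCt)` with `C = λ₁C₁ + λ₂C₂`. -/
noncomputable def F2 {d : ℕ} (C₁ C₂ : Matrix (Fin d) (Fin d) ℝ) (l₁ l₂ : ℝ)
    (t : Fin d → ℝ) : ℝ :=
  F1 C₁ C₂ l₁ l₂ t * Real.log ((2 * Real.pi) ^ d * (l₁ • C₁ + l₂ • C₂).det) +
    l₁ * Real.exp ((1 / 2) * (t ⬝ᵥ C₁ *ᵥ t)) * ((l₁ • C₁ + l₂ • C₂)⁻¹ * C₁).trace +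
    l₂ * Real.exp ((1 / 2) * (t ⬝ᵥ C₂ *ᵥ t)) * ((l₁ • C₁ + l₂ • C₂)⁻¹ * C₂).trace -
    d * Real.exp ((1 / 2) * (t ⬝ᵥ (l₁ • C₁ + l₂ • C₂) *ᵥ t))

open scoped MatrixOrder Matrix.Norms.L2Operator in
theorem Matrix.PosDef.exists_isUnit_eq_conjTranspose_mul_self {n : Type*} [Fintype n]
    [DecidableEq n] {A : Matrix n n ℝ} (hA : A.PosDef) :
    ∃ B : Matrix n n ℝ, IsUnit B ∧ A = Bᴴ * B :=
  CStarAlgebra.isStrictlyPositive_iff_eq_star_mul_self.mp hA.isStrictlyPositive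

theorem Matrix.PosDef.log_det_eq_sum {n : Type*} [Fintype n] [DecidableEq n]
    {A : Matrix n n ℝ} (hA : A.PosDef) :
    Real.log A.det = ∑ i, Real.log (hA.1.eigenvalues i) := by
  rw [hA.1.det_eq_prod_eigenvalues]
  exact Real.log_prod fun i _ => (hA.eigenvalues_pos i).ne'

theorem Matrix.PosDef.eq_one_of_trace_sub_card_le_log_det {n : Type*} [Fintype n] [DecidableEq n]
    {A : Matrix n n ℝ} (hA : A.PosDef) (h : A.trace - Fintype.card n ≤ Real.log A.det) :
    A = 1 := by
  have hone : ∀ i, hA.1.eigenvalues i = 1 := by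
    by_contra! hne
    obtain ⟨i, hi⟩ := hne
    have hlt : ∑ i, Real.log (hA.1.eigenvalues i) < ∑ i, (hA.1.eigenvalues i - 1) :=
      Finset.sum_lt_sum (fun j _ => Real.log_le_sub_one_of_pos (hA.eigenvalues_pos j))
        ⟨i, Finset.mem_univ i, Real.log_lt_sub_one_of_pos (hA.eigenvalues_pos i) hi⟩
    rw [hA.log_det_eq_sum, hA.1.trace_eq_sum_eigenvalues] at h
    simp only [Finset.sum_sub_distrib, Finset.sum_const, Finset.card_univ, nsmul_eq_mul,
      mul_one] at hlt
    exact absurd hlt (not_lt.mpr (by simpa using h))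
  have hdiag : diagonal (RCLike.ofReal ∘ hA.1.eigenvalues) = (1 : Matrix n n ℝ) := by
    ext i j
    simp [diagonal_apply, one_apply, hone]
  rw [hA.1.spectral_theorem, hdiag, map_one]

/-- The congruence that turns `C` into `1` turns `A` into a matrix `M` with `det M = det A / det C`
and `tr M = tr (C⁻¹ A)`. -/
theorem Matrix.PosDef.exists_posDef_det_trace {n : Type*} [Fintype n] [DecidableEq n]
    {A C : Matrix n n ℝ} (hA : A.PosDef) (hC : C.PosDef) :
    ∃ M : Matrix n n ℝ, M.PosDef ∧ Real.log M.det = Real.log A.det - Real.log C.det ∧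
      M.trace = (C⁻¹ * A).trace ∧ (M = 1 → A = C) := by
  obtain ⟨B, hB, hCB⟩ := hC.inv.exists_isUnit_eq_conjTranspose_mul_self
  have hCdet : IsUnit C.det := hC.det_pos.ne'.isUnit
  refine ⟨B * A * Bᴴ, (hB.posDef_star_right_conjugate_iff).mpr hA, ?_, ?_, fun hM => ?_⟩
  · have hdet : (B * A * Bᴴ).det = A.det * C.det⁻¹ := by
      rw [← Ring.inverse_eq_inv', ← det_nonsing_inv, hCB]
      simp only [det_mul]
      ring
    rw [hdet, Real.log_mul hA.det_pos.ne' (inv_ne_zero hC.det_pos.ne'), Real.log_inv]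
    ring
  · rw [trace_mul_comm, ← mul_assoc, hCB]
  · have hinv : A * C⁻¹ = 1 := by
      apply hB.mul_left_cancel
      rw [hCB, ← mul_assoc, ← mul_assoc, hM, one_mul, mul_one]
    calc A = A * C⁻¹ * C := by rw [mul_assoc, nonsing_inv_mul _ hCdet, mul_one]
      _ = C := by rw [hinv, one_mul]

theorem Matrix.PosDef.log_det_le_log_det_add_trace {n : Type*} [Fintype n] [DecidableEq n]
    {A C : Matrix n n ℝ} (hA : A.PosDef) (hC : C.PosDef) :
    Real.log A.det ≤ Real.log C.det + (C⁻¹ * A).trace - Fintype.card n := by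
  obtain ⟨M, hM, hdet, htrace, -⟩ := hA.exists_posDef_det_trace hC
  linarith [hM.log_det_le_trace_sub_card]

theorem Matrix.PosDef.eq_of_log_det_add_trace_le {n : Type*} [Fintype n] [DecidableEq n]
    {A C : Matrix n n ℝ} (hA : A.PosDef) (hC : C.PosDef)
    (h : Real.log C.det + (C⁻¹ * A).trace - Fintype.card n ≤ Real.log A.det) : A = C := by
  obtain ⟨M, hM, hdet, htrace, himp⟩ := hA.exists_posDef_det_trace hC
  exact himp (hM.eq_one_of_trace_sub_card_le_log_det (by linarith))

theorem Real.log_two_pi_exp_pow_mul (d : ℕ) {x : ℝ} (hx : 0 < x) :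
    Real.log ((2 * π * Real.exp 1) ^ d * x) = d * Real.log (2 * π) + d + Real.log x := by
  rw [Real.log_mul (by positivity) hx.ne', Real.log_pow,
    Real.log_mul (by positivity) (Real.exp_ne_zero 1), Real.log_exp]
  ring

/-- **Exponentially weighted Ky Fan inequality** (equality part). -/
theorem exp_weighted_ky_fan_equality_iff {d : ℕ}
    (C₁ C₂ : Matrix (Fin d) (Fin d) ℝ) (hC₁ : C₁.PosDef) (hC₂ : C₂.PosDef)
    (l₁ l₂ : ℝ) (hl₁ : l₁ ∈ Set.Icc (0 : ℝ) 1) (hl₂ : l₂ ∈ Set.Icc (0 : ℝ) 1)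
    (hsum : l₁ + l₂ = 1) (t : Fin d → ℝ)
    (hF1 : 0 ≤ F1 C₁ C₂ l₁ l₂ t) (hF2 : F2 C₁ C₂ l₁ l₂ t ≤ 0) :
    (1 / 2) * Real.log ((2 * Real.pi * Real.exp 1) ^ d * (l₁ • C₁ + l₂ • C₂).det) *
        Real.exp ((1 / 2) * (t ⬝ᵥ (l₁ • C₁ + l₂ • C₂) *ᵥ t)) =
      l₁ * ((1 / 2) * Real.log ((2 * Real.pi * Real.exp 1) ^ d * C₁.det)) *
          Real.exp ((1 / 2) * (t ⬝ᵥ C₁ *ᵥ t)) +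
        l₂ * ((1 / 2) * Real.log ((2 * Real.pi * Real.exp 1) ^ d * C₂.det)) *
          Real.exp ((1 / 2) * (t ⬝ᵥ C₂ *ᵥ t)) ↔
      l₁ * l₂ = 0 ∨ C₁ = C₂ := by
  have hself (A : Matrix (Fin d) (Fin d) ℝ) : l₁ • A + l₂ • A = A := by
    rw [← add_smul, hsum, one_smul]
  constructor
  · intro heq
    by_contra! hne
    obtain ⟨hl, hC⟩ := hne
    have hpos₁ : 0 < l₁ := lt_of_le_of_ne hl₁.1 (Ne.symm (left_ne_zero_of_mul hl))
    have hpos₂ : 0 < l₂ := lt_of_le_of_ne hl₂.1 (Ne.symm (right_ne_zero_of_mul hl))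
    have hpd : (l₁ • C₁ + l₂ • C₂).PosDef := (hC₁.smul hpos₁).add (hC₂.smul hpos₂)
    rw [log_two_pi_exp_pow_mul d hpd.det_pos, log_two_pi_exp_pow_mul d hC₁.det_pos,
      log_two_pi_exp_pow_mul d hC₂.det_pos] at heq
    rw [F2, F1, Real.log_mul (by positivity) hpd.det_pos.ne', Real.log_pow] at hF2
    have hle₁ := hC₁.log_det_le_log_det_add_trace hpd
    have hle₂ := hC₂.log_det_le_log_det_add_trace hpd
    have hconv₁ := hC₁.eq_of_log_det_add_trace_le hpd
    have hconv₂ := hC₂.eq_of_log_det_add_trace_le hpd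
    rw [Fintype.card_fin] at hle₁ hle₂ hconv₁ hconv₂
    have hw₁ := mul_pos hpos₁ (Real.exp_pos ((1 / 2) * (t ⬝ᵥ C₁ *ᵥ t)))
    have hw₂ := mul_pos hpos₂ (Real.exp_pos ((1 / 2) * (t ⬝ᵥ C₂ *ᵥ t)))
    have hgap₁ := mul_nonneg hw₁.le (sub_nonneg.mpr hle₁)
    have hgap₂ := mul_nonneg hw₂.le (sub_nonneg.mpr hle₂)
    refine hC ((hconv₁ ?_).trans (hconv₂ ?_).symm)
    · exact sub_nonpos.mp (nonpos_of_mul_nonpos_right (by linarith) hw₁)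
    · exact sub_nonpos.mp (nonpos_of_mul_nonpos_right (by linarith) hw₂)
  · rintro (h | rfl)
    · rcases mul_eq_zero.mp h with rfl | rfl
      · obtain rfl : l₂ = 1 := by linarith
        simp
      · obtain rfl : l₁ = 1 := by linarith
        simp
    · rw [hself, ← add_mul, ← add_mul, hsum, one_mul]
end

section
/- (EKFI in Σ-form.) Let C₁, C₂ be symmetric strictly positive definite d×d real matrices, λ₁, λ₂ ∈ [0,1] with λ₁ + λ₂ = 1, and C = λ₁C₁ + λ₂C₂. For every t ∈ S one has Σ(t) := log[(2πe)^d det C]·exp(½tᵀCt) − Σ_{a=1,2} λ_a log[(2πe)^d det C_a]·exp(½tᵀC_a t) ≥ 0. -/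
open Matrix Real

open scoped MatrixOrder in
/-- The Kullback–Leibler divergence between centred Gaussians with covariances `B` and `A` is
nonnegative. -/
theorem log_det_le_log_det_add_trace_sub {d : ℕ} {A B : Matrix (Fin d) (Fin d) ℝ}
    (hA : A.PosDef) (hB : B.PosDef) :
    Real.log B.det ≤ Real.log A.det + (A⁻¹ * B).trace - d := by
  obtain ⟨S, hS⟩ := CStarAlgebra.nonneg_iff_eq_star_mul_self.mp hA.inv.posSemidef.nonneg
  rw [Matrix.star_eq_conjTranspose] at hS
  have hSdet : IsUnit S := by
    rw [Matrix.isUnit_iff_isUnit_det, isUnit_iff_ne_zero]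
    intro h
    have := hA.inv.det_pos
    simp [hS, h] at this
  have hM : (S * B * Sᴴ).PosDef :=
    hB.mul_mul_conjTranspose_same (Matrix.vecMul_injective_of_isUnit hSdet)
  have htr : (A⁻¹ * B).trace = (S * B * Sᴴ).trace := by
    rw [hS, Matrix.mul_assoc, Matrix.trace_mul_comm]
  have hdet : (S * B * Sᴴ).det = A.det⁻¹ * B.det := by
    rw [← Ring.inverse_eq_inv', ← Matrix.det_nonsing_inv, hS]
    simp only [Matrix.det_mul]
    ring
  have hlog : Real.log (S * B * Sᴴ).det = Real.log B.det - Real.log A.det := by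
    rw [hdet, Real.log_mul (inv_ne_zero hA.det_pos.ne') hB.det_pos.ne', Real.log_inv]
    ring
  have hle : Real.log (S * B * Sᴴ).det ≤ (S * B * Sᴴ).trace - d := by
    rw [hM.1.det_eq_prod_eigenvalues, hM.1.trace_eq_sum_eigenvalues]
    simp only [RCLike.ofReal_real_eq_id, id]
    rw [Real.log_prod fun i _ => (hM.eigenvalues_pos i).ne']
    calc _ ≤ ∑ i, (hM.1.eigenvalues i - 1) :=
          Finset.sum_le_sum fun i _ => Real.log_le_sub_one_of_pos (hM.eigenvalues_pos i)
      _ = _ := by simp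
  linarith

/-- **EKFI in Σ-form**: for `t ∈ S`,
`Σ(t) = log[(2πe)^d det C]·exp(½tᵀCt) − Σ_a λ_a log[(2πe)^d det C_a]·exp(½tᵀC_a t) ≥ 0`. -/
theorem exp_weighted_ky_fan_sigma_form {d : ℕ}
    (C₁ C₂ : Matrix (Fin d) (Fin d) ℝ) (hC₁ : C₁.PosDef) (hC₂ : C₂.PosDef)
    (l₁ l₂ : ℝ) (hl₁ : l₁ ∈ Set.Icc (0 : ℝ) 1) (hl₂ : l₂ ∈ Set.Icc (0 : ℝ) 1)
    (hsum : l₁ + l₂ = 1) (t : Fin d → ℝ)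
    (hF1 : 0 ≤ F1 C₁ C₂ l₁ l₂ t) (hF2 : F2 C₁ C₂ l₁ l₂ t ≤ 0) :
    0 ≤ Real.log ((2 * Real.pi * Real.exp 1) ^ d * (l₁ • C₁ + l₂ • C₂).det) *
          Real.exp ((1 / 2) * (t ⬝ᵥ (l₁ • C₁ + l₂ • C₂) *ᵥ t)) -
        (l₁ * Real.log ((2 * Real.pi * Real.exp 1) ^ d * C₁.det) *
            Real.exp ((1 / 2) * (t ⬝ᵥ C₁ *ᵥ t)) +
          l₂ * Real.log ((2 * Real.pi * Real.exp 1) ^ d * C₂.det) *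
            Real.exp ((1 / 2) * (t ⬝ᵥ C₂ *ᵥ t))) := by
  obtain ⟨h₁, -⟩ := hl₁
  obtain ⟨h₂, -⟩ := hl₂
  have hC : (l₁ • C₁ + l₂ • C₂).PosDef := by
    rcases h₁.eq_or_lt with rfl | h
    · simpa [show l₂ = 1 by linarith] using hC₂
    · exact (hC₁.smul h).add_posSemidef (hC₂.posSemidef.smul h₂)
  have log_const_mul {x : ℝ} (hx : 0 < x) :
      Real.log ((2 * Real.pi * Real.exp 1) ^ d * x) =
        d * Real.log (2 * Real.pi) + d + Real.log x := by
    rw [Real.log_mul (by positivity) hx.ne', Real.log_pow,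
      Real.log_mul (by positivity) (Real.exp_pos 1).ne', Real.log_exp]
    ring
  have k₁ := mul_le_mul_of_nonneg_left (log_det_le_log_det_add_trace_sub hC hC₁)
    (mul_nonneg h₁ (Real.exp_pos ((1 / 2) * (t ⬝ᵥ C₁ *ᵥ t))).le)
  have k₂ := mul_le_mul_of_nonneg_left (log_det_le_log_det_add_trace_sub hC hC₂)
    (mul_nonneg h₂ (Real.exp_pos ((1 / 2) * (t ⬝ᵥ C₂ *ᵥ t))).le)
  rw [log_const_mul hC.det_pos, log_const_mul hC₁.det_pos, log_const_mul hC₂.det_pos]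
  rw [F2, F1, Real.log_mul (by positivity) hC.det_pos.ne', Real.log_pow] at hF2
  linarith
end
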